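/- Let κ>0, M>0, T>0 and λ := √(κ²+M). Then the reflection coefficient satisfies |C₂| ≤ (λ²−κ²)|sin(λT)| / (2λκ) ≤ M/(2κ²). In particular C₂ → 0 as M → 0 (for fixed κ, T), so the effective field converges to the incident wave e^{iκt} on (−∞,0) in this limit. -/

import Mathlib

/-- `λ = √(κ² + M)`. -/
noncomputable def lamEff (κ M : ℝ) : ℝ := Real.sqrt (κ ^ 2 + M)

/-- `D = (λ+κ)² e^{−iλT} − (λ−κ)² e^{iλT}`. -/
noncomputable def Dcoef (κ M T : ℝ) : ℂ :=
  ((lamEff κ M + κ : ℝ) : ℂ) ^ 2 * Complex.exp (-(Complex.I * lamEff κ M * T)) -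
    ((lamEff κ M - κ : ℝ) : ℂ) ^ 2 * Complex.exp (Complex.I * lamEff κ M * T)

/-- Reflection coefficient `C₂ = (λ²−κ²)(e^{iλT}−e^{−iλT})/D`. -/
noncomputable def C2coef (κ M T : ℝ) : ℂ :=
  ((lamEff κ M ^ 2 - κ ^ 2 : ℝ) : ℂ) *
    (Complex.exp (Complex.I * lamEff κ M * T) - Complex.exp (-(Complex.I * lamEff κ M * T))) /
      Dcoef κ M T

/-- `C₃ = 2κ(λ+κ)e^{−iλT}/D`. -/
noncomputable def C3coef (κ M T : ℝ) : ℂ :=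
  ((2 * κ * (lamEff κ M + κ) : ℝ) : ℂ) * Complex.exp (-(Complex.I * lamEff κ M * T)) /
    Dcoef κ M T

/-- `C₄ = 2κ(λ−κ)e^{iλT}/D`. -/
noncomputable def C4coef (κ M T : ℝ) : ℂ :=
  ((2 * κ * (lamEff κ M - κ) : ℝ) : ℂ) * Complex.exp (Complex.I * lamEff κ M * T) /
    Dcoef κ M T

/-- Transmission coefficient `C₅ = 4κλ e^{−iκT}/D`. -/
noncomputable def C5coef (κ M T : ℝ) : ℂ :=
  ((4 * κ * lamEff κ M : ℝ) : ℂ) * Complex.exp (-(Complex.I * κ * T)) / Dcoef κ M T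

/-- The effective field `u_eff`. -/
noncomputable def ueff (κ M T t : ℝ) : ℂ :=
  if t < 0 then
    Complex.exp (Complex.I * κ * t) + C2coef κ M T * Complex.exp (-(Complex.I * κ * t))
  else if t ≤ T then
    C3coef κ M T * Complex.exp (Complex.I * lamEff κ M * t) +
      C4coef κ M T * Complex.exp (-(Complex.I * lamEff κ M * t))
  else
    C5coef κ M T * Complex.exp (Complex.I * κ * t)

theorem lamEff_sq {κ M : ℝ} (hM : 0 ≤ M) : lamEff κ M ^ 2 = κ ^ 2 + M :=
  Real.sq_sqrt (by positivity)

theorem lt_lamEff {κ M : ℝ} (hM : 0 < M) : κ < lamEff κ M :=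
  Real.lt_sqrt_of_sq_lt (by linarith)

theorem norm_exp_sub_exp_neg (θ : ℝ) :
    ‖Complex.exp (Complex.I * θ) - Complex.exp (-(Complex.I * θ))‖ = 2 * |Real.sin θ| := by
  have h : Complex.exp (Complex.I * θ) - Complex.exp (-(Complex.I * θ)) =
      2 * Complex.I * (Real.sin θ : ℂ) := by
    have h₁ := Complex.exp_mul_I (θ : ℂ)
    have h₂ := Complex.exp_mul_I (-(θ : ℂ))
    rw [Complex.cos_neg, Complex.sin_neg] at h₂
    rw [show -(Complex.I * (θ : ℂ)) = -(θ : ℂ) * Complex.I by ring, mul_comm Complex.I, h₁, h₂,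
      Complex.ofReal_sin]
    ring
  rw [h, norm_mul, norm_mul, Complex.norm_real, Complex.norm_I, Complex.norm_two, mul_one,
    Real.norm_eq_abs]

theorem le_norm_Dcoef (κ M T : ℝ) : 4 * lamEff κ M * κ ≤ ‖Dcoef κ M T‖ := by
  have h := norm_sub_norm_le
    (((lamEff κ M + κ : ℝ) : ℂ) ^ 2 * Complex.exp (-(Complex.I * lamEff κ M * T)))
    (((lamEff κ M - κ : ℝ) : ℂ) ^ 2 * Complex.exp (Complex.I * lamEff κ M * T))
  have h₁ : ‖Complex.exp (Complex.I * lamEff κ M * T)‖ = 1 := by simp [Complex.norm_exp]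
  have h₂ : ‖Complex.exp (-(Complex.I * lamEff κ M * T))‖ = 1 := by simp [Complex.norm_exp]
  rw [norm_mul, norm_mul, h₁, h₂, norm_pow, norm_pow, Complex.norm_real, Complex.norm_real,
    Real.norm_eq_abs, Real.norm_eq_abs, sq_abs, sq_abs] at h
  rw [Dcoef]
  linarith

theorem norm_C2coef_le {κ M : ℝ} (T : ℝ) (hκ : 0 < κ) (hM : 0 < M) :
    ‖C2coef κ M T‖ ≤
      (lamEff κ M ^ 2 - κ ^ 2) * |Real.sin (lamEff κ M * T)| / (2 * lamEff κ M * κ) := by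
  have hl : 0 < lamEff κ M := hκ.trans (lt_lamEff hM)
  have hd : 0 ≤ lamEff κ M ^ 2 - κ ^ 2 := by rw [lamEff_sq hM.le]; linarith
  have hs := norm_exp_sub_exp_neg (lamEff κ M * T)
  rw [Complex.ofReal_mul, ← mul_assoc] at hs
  rw [C2coef, norm_div, norm_mul, hs, Complex.norm_real, Real.norm_of_nonneg hd]
  calc (lamEff κ M ^ 2 - κ ^ 2) * (2 * |Real.sin (lamEff κ M * T)|) / ‖Dcoef κ M T‖
      ≤ (lamEff κ M ^ 2 - κ ^ 2) * (2 * |Real.sin (lamEff κ M * T)|) / (4 * lamEff κ M * κ) := by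
        gcongr
        exact le_norm_Dcoef κ M T
    _ = _ := by
        field_simp
        ring

theorem reflection_bound_le {κ M : ℝ} (T : ℝ) (hκ : 0 < κ) (hM : 0 < M) :
    (lamEff κ M ^ 2 - κ ^ 2) * |Real.sin (lamEff κ M * T)| / (2 * lamEff κ M * κ) ≤
      M / (2 * κ ^ 2) := by
  have hl : κ < lamEff κ M := lt_lamEff hM
  rw [lamEff_sq hM.le, add_sub_cancel_left]
  apply div_le_div₀ hM.le _ (by positivity) (by nlinarith)
  exact mul_le_of_le_one_right hM.le (Real.abs_sin_le_one _)

theorem tendsto_C2coef_zero {κ : ℝ} (T : ℝ) (hκ : 0 < κ) :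
    Filter.Tendsto (fun M : ℝ => C2coef κ M T) (nhdsWithin 0 (Set.Ioi 0)) (nhds 0) := by
  apply squeeze_zero_norm' (a := fun M : ℝ => M / (2 * κ ^ 2))
  · filter_upwards [self_mem_nhdsWithin] with M hM
    exact (norm_C2coef_le T hκ hM).trans (reflection_bound_le T hκ hM)
  · have h : Filter.Tendsto (fun M : ℝ => M / (2 * κ ^ 2)) (nhds 0) (nhds (0 / (2 * κ ^ 2))) :=
      Filter.tendsto_id.div_const _
    rw [zero_div] at h
    exact h.mono_left nhdsWithin_le_nhds

/-- `|C₂| ≤ (λ²−κ²)|sin(λT)|/(2λκ) ≤ M/(2κ²)`; in particular `C₂ → 0` as `M → 0⁺` and the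
effective field converges to the incident wave `e^{iκt}` on `(−∞,0)` in this limit. -/
theorem stmt12 (κ M T : ℝ) (hκ : 0 < κ) (hM : 0 < M) (hT : 0 < T) :
    ‖C2coef κ M T‖ ≤
        (lamEff κ M ^ 2 - κ ^ 2) * |Real.sin (lamEff κ M * T)| / (2 * lamEff κ M * κ) ∧
    (lamEff κ M ^ 2 - κ ^ 2) * |Real.sin (lamEff κ M * T)| / (2 * lamEff κ M * κ) ≤
        M / (2 * κ ^ 2) ∧
    Filter.Tendsto (fun M' : ℝ => C2coef κ M' T) (nhdsWithin 0 (Set.Ioi 0)) (nhds 0) ∧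
    ∀ t : ℝ, t < 0 →
      Filter.Tendsto (fun M' : ℝ => ueff κ M' T t) (nhdsWithin 0 (Set.Ioi 0))
        (nhds (Complex.exp (Complex.I * κ * t))) := by
  refine ⟨norm_C2coef_le T hκ hM, reflection_bound_le T hκ hM, tendsto_C2coef_zero T hκ, ?_⟩
  intro t ht
  simp only [ueff, if_pos ht]
  simpa using ((tendsto_C2coef_zero T hκ).mul_const
    (Complex.exp (-(Complex.I * κ * t)))).const_add (Complex.exp (Complex.I * κ * t))
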